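/- arXiv:2208.04923 — 2 statements merged into one kernel-verified Lean document; each statement's English description precedes it below -/
import Mathlib

section
/- Let n ≥ 3 and B > 0. Let ψ : ℝⁿ → ℝ be continuous and ℤⁿ-periodic with ψ ≤ 0 on ℝⁿ, ψ(0) = 0, and ψ(x) ≥ −B|x|² for all |x| ≤ 1/2. Then there exists a constant C > 0 depending only on n and B such that for every μ ∈ (0,1] and every continuous ℤⁿ-periodic function v : ℝⁿ → ℝ satisfying v ≥ ψ on ℝⁿ and Δv ≤ μ weakly in ℝⁿ, one has v(x) ≥ −C μ^{2/n} for all x ∈ ℝⁿ. In particular, the height 𝓔(μ) of the minimal such supersolution satisfies 𝓔(μ) ≤ C μ^{2/n}. -/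
open MeasureTheory Metric Set

/-- The (pointwise) Laplacian of a smooth `f : ℝⁿ → ℝ`. -/
noncomputable def lapl (n : ℕ) (f : EuclideanSpace ℝ (Fin n) → ℝ)
    (x : EuclideanSpace ℝ (Fin n)) : ℝ :=
  ∑ i : Fin n, fderiv ℝ (fun y => fderiv ℝ f y (EuclideanSpace.single i 1)) x
    (EuclideanSpace.single i 1)

/-- `f : ℝⁿ → ℝ` is `ℤⁿ`-periodic. -/
def IsZnPeriodic (n : ℕ) (f : EuclideanSpace ℝ (Fin n) → ℝ) : Prop :=
  ∀ (x : EuclideanSpace ℝ (Fin n)) (k : Fin n → ℤ),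
    f (x + (WithLp.equiv 2 (Fin n → ℝ)).symm (fun i => (k i : ℝ))) = f x

/-- `Δw ≤ c` weakly in `V`. -/
def LapLeWeak (n : ℕ) (V : Set (EuclideanSpace ℝ (Fin n)))
    (w : EuclideanSpace ℝ (Fin n) → ℝ) (c : ℝ) : Prop :=
  ∀ φ : EuclideanSpace ℝ (Fin n) → ℝ, ContDiff ℝ (⊤ : ℕ∞) φ → HasCompactSupport φ →
    tsupport φ ⊆ V → (∀ x, 0 ≤ φ x) →
    ∫ x in V, w x * lapl n φ x ≤ c * ∫ x in V, φ x

open scoped Convolution Topology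

/-- A function with a local minimum has nonnegative second derivative there. -/
theorem second_deriv_nonneg_of_isLocalMin {g g' : ℝ → ℝ} {a c : ℝ} (hmin : IsLocalMin g a)
    (hg : ∀ᶠ t in 𝓝 a, HasDerivAt g (g' t) t) (hg' : HasDerivAt g' c a) : 0 ≤ c := by
  by_contra! hc
  have hderiv : deriv g =ᶠ[𝓝 a] g' := hg.mono fun t ht => ht.deriv
  have h2 : deriv (deriv g) a = c := (hg'.congr_of_eventuallyEq hderiv).deriv
  have hmax : IsLocalMax g a :=
    isLocalMax_of_deriv_deriv_neg (by rw [h2]; exact hc) hmin.deriv_eq_zero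
      hg.self_of_nhds.continuousAt
  have hconst : g =ᶠ[𝓝 a] fun _ => g a := by
    filter_upwards [hmin, hmax] with t h1 h2 using le_antisymm h2 h1
  have h3 : deriv g =ᶠ[𝓝 a] fun _ => 0 := by
    simpa using hconst.deriv
  rw [h3.deriv_eq, deriv_const] at h2
  exact hc.ne h2.symm

section Mollification

variable {n : ℕ}

/-- The mollification of `v` by `φ`. -/
noncomputable def mollify (v φ : EuclideanSpace ℝ (Fin n) → ℝ) (x : EuclideanSpace ℝ (Fin n)) : ℝ :=
  ∫ y, v y * φ (x - y)

variable {v φ : EuclideanSpace ℝ (Fin n) → ℝ}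

theorem mollify_eq_convolution :
    mollify v φ = v ⋆[ContinuousLinearMap.lsmul ℝ ℝ, volume] φ := by
  ext x; simp [mollify, convolution_def]

theorem mollify_eq_swap (x : EuclideanSpace ℝ (Fin n)) :
    mollify v φ x = ∫ t, v (x - t) * φ t := by
  rw [mollify, ← integral_sub_left_eq_self _ volume x]
  simp

theorem mollify_periodic (hv : IsZnPeriodic n v) : IsZnPeriodic n (mollify v φ) := by
  intro x k
  simp only [mollify_eq_swap]
  congr 1; ext t
  rw [add_sub_right_comm, hv]

theorem integrable_mollify_kernel (hv : Continuous v) (hφ : Continuous φ)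
    (hc : HasCompactSupport φ) (x : EuclideanSpace ℝ (Fin n)) :
    Integrable fun t => v (x - t) * φ t :=
  (Continuous.mul (by fun_prop) hφ).integrable_of_hasCompactSupport hc.mul_left

theorem hasDerivAt_mollify_line (hv : Continuous v) (hφ : ContDiff ℝ 1 φ)
    (hc : HasCompactSupport φ) (x e : EuclideanSpace ℝ (Fin n)) (t : ℝ) :
    HasDerivAt (fun t : ℝ => mollify v φ (x + t • e))
      (mollify v (fun y => fderiv ℝ φ y e) (x + t • e)) t := by
  have h := hc.hasFDerivAt_convolution_right (ContinuousLinearMap.lsmul ℝ ℝ)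
    (hv.locallyIntegrable (μ := volume)) hφ (x + t • e)
  have hl : HasDerivAt (fun t : ℝ => x + t • e) e t := by
    simpa using ((hasDerivAt_id t).smul_const e).const_add x
  have h' := h.comp_hasDerivAt t hl
  rw [convolution_precompR_apply _ (hv.locallyIntegrable) (hc.fderiv ℝ)
    (hφ.continuous_fderiv one_ne_zero)] at h'
  simp only [mollify_eq_convolution]
  exact h'

theorem contDiff_fderiv_apply_const (hφ : ContDiff ℝ (⊤ : ℕ∞) φ) (e : EuclideanSpace ℝ (Fin n)) :
    ContDiff ℝ (⊤ : ℕ∞) fun y => fderiv ℝ φ y e :=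
  (hφ.fderiv_right (by simp)).clm_apply contDiff_const

theorem fderiv_comp_const_sub_apply (hφ : Differentiable ℝ φ) (x y e : EuclideanSpace ℝ (Fin n)) :
    fderiv ℝ (fun y => φ (x - y)) y e = -fderiv ℝ φ (x - y) e := by
  have h := (hφ (x - y)).hasFDerivAt.comp y ((hasFDerivAt_id y).const_sub x)
  change HasFDerivAt (fun y => φ (x - y)) _ y at h
  rw [h.fderiv]; simp

theorem lapl_comp_const_sub (hφ : ContDiff ℝ (⊤ : ℕ∞) φ) (x y : EuclideanSpace ℝ (Fin n)) :
    lapl n (fun y => φ (x - y)) y = lapl n φ (x - y) := by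
  unfold lapl
  refine Finset.sum_congr rfl fun i _ => ?_
  simp only [fderiv_comp_const_sub_apply (hφ.differentiable (by simp))]
  rw [fderiv_fun_neg, neg_apply, fderiv_comp_const_sub_apply
    ((contDiff_fderiv_apply_const hφ _).differentiable (by simp)), neg_neg]

theorem sum_mollify_second_deriv_le {c : ℝ} (hv : Continuous v) (hw : LapLeWeak n univ v c)
    (hφ : ContDiff ℝ (⊤ : ℕ∞) φ) (hc : HasCompactSupport φ) (h0 : ∀ x, 0 ≤ φ x)
    (h1 : ∫ x, φ x = 1) (x : EuclideanSpace ℝ (Fin n)) :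
    ∑ i : Fin n, mollify v (fun y => fderiv ℝ (fun z => fderiv ℝ φ z (EuclideanSpace.single i 1)) y
      (EuclideanSpace.single i 1)) x ≤ c := by
  have hsupp : HasCompactSupport fun y => φ (x - y) :=
    hc.comp_homeomorph (Homeomorph.subLeft x)
  have h := hw (fun y => φ (x - y)) (by fun_prop) hsupp (subset_univ _) fun y => h0 _
  rw [setIntegral_univ, setIntegral_univ, integral_sub_left_eq_self φ volume x, h1, mul_one] at h
  refine le_trans (le_of_eq ?_) h
  simp only [lapl_comp_const_sub hφ]
  simp only [mollify, lapl, Finset.mul_sum]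
  rw [integral_finsetSum]
  intro i _
  have hd := contDiff_fderiv_apply_const (contDiff_fderiv_apply_const hφ
    (EuclideanSpace.single i 1)) (EuclideanSpace.single i 1)
  have hs : HasCompactSupport fun y => fderiv ℝ (fun z => fderiv ℝ φ z (EuclideanSpace.single i 1)) y
      (EuclideanSpace.single i 1) := (hc.fderiv_apply ℝ _).fderiv_apply ℝ _
  have := hd.continuous
  exact (Continuous.mul hv (by fun_prop)).integrable_of_hasCompactSupport
    (hs.comp_homeomorph (Homeomorph.subLeft x)).mul_left

theorem le_mollify {c ε : ℝ} (hv : Continuous v) (hφ : Continuous φ) (hc : HasCompactSupport φ)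
    (h0 : ∀ x, 0 ≤ φ x) (h1 : ∫ x, φ x = 1) (hε : ∀ t, φ t ≠ 0 → ‖t‖ < ε)
    {x : EuclideanSpace ℝ (Fin n)} (hx : ∀ y, ‖x - y‖ < ε → c ≤ v y) : c ≤ mollify v φ x := by
  rw [mollify_eq_swap]
  calc c = ∫ t, c * φ t := by rw [integral_const_mul, h1, mul_one]
    _ ≤ _ := by
      refine integral_mono ((hφ.integrable_of_hasCompactSupport hc).const_mul c)
        (integrable_mollify_kernel hv hφ hc x) fun t => ?_
      by_cases ht : φ t = 0
      · simp [ht]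
      · exact mul_le_mul_of_nonneg_right (hx _ (by simpa using hε t ht)) (h0 t)

theorem mollify_le {c ε : ℝ} (hv : Continuous v) (hφ : Continuous φ) (hc : HasCompactSupport φ)
    (h0 : ∀ x, 0 ≤ φ x) (h1 : ∫ x, φ x = 1) (hε : ∀ t, φ t ≠ 0 → ‖t‖ < ε)
    {x : EuclideanSpace ℝ (Fin n)} (hx : ∀ y, ‖x - y‖ < ε → v y ≤ c) : mollify v φ x ≤ c := by
  have h := le_mollify (v := fun y => -v y) (c := -c) hv.neg hφ hc h0 h1 hε
    fun y hy => neg_le_neg (hx y hy)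
  have : mollify (fun y => -v y) φ x = -mollify v φ x := by
    simp [mollify, integral_neg]
  linarith

theorem continuous_mollify (hv : Continuous v) (hφ : Continuous φ) (hc : HasCompactSupport φ) :
    Continuous (mollify v φ) := by
  rw [mollify_eq_convolution]
  exact hc.continuous_convolution_right _ hv.locallyIntegrable hφ

theorem exists_mollifier (n : ℕ) {ε : ℝ} (hε : 0 < ε) :
    ∃ φ : EuclideanSpace ℝ (Fin n) → ℝ, ContDiff ℝ (⊤ : ℕ∞) φ ∧ HasCompactSupport φ ∧
      (∀ x, 0 ≤ φ x) ∧ ∫ x, φ x = 1 ∧ ∀ t, φ t ≠ 0 → ‖t‖ < ε := by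
  let f : ContDiffBump (0 : EuclideanSpace ℝ (Fin n)) := ⟨ε / 2, ε, by positivity, by linarith⟩
  refine ⟨f.normed volume, f.contDiff_normed, f.hasCompactSupport_normed, f.nonneg_normed,
    f.integral_normed, fun t ht => ?_⟩
  have : t ∈ Function.support (f.normed volume) := ht
  rw [f.support_normed_eq] at this
  simpa [f] using this

end Mollification

section Barrier

/-- The profile `Φ` for which `x ↦ Φ (‖x‖²)` has Laplacian `1` away from the origin in `ℝⁿ` and
decreases in `‖x‖` up to `‖x‖ = √n`. -/
noncomputable def barrierProfile (n : ℕ) (q : ℝ) : ℝ :=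
  (n : ℝ) ^ ((n : ℝ) / 2) * q ^ (1 - (n : ℝ) / 2) + q / (2 * n)

/-- The derivative of `barrierProfile`. -/
noncomputable def barrierProfileDeriv (n : ℕ) (q : ℝ) : ℝ :=
  (n : ℝ) ^ ((n : ℝ) / 2) * ((1 - (n : ℝ) / 2) * q ^ (-(n : ℝ) / 2)) + 1 / (2 * n)

/-- The second derivative of `barrierProfile`. -/
noncomputable def barrierProfileDeriv2 (n : ℕ) (q : ℝ) : ℝ :=
  (n : ℝ) ^ ((n : ℝ) / 2) * ((1 - (n : ℝ) / 2) * ((-(n : ℝ) / 2) * q ^ (-(n : ℝ) / 2 - 1)))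

variable {n : ℕ} {q : ℝ}

theorem hasDerivAt_barrierProfile (hq : 0 < q) :
    HasDerivAt (barrierProfile n) (barrierProfileDeriv n q) q := by
  have h := (Real.hasDerivAt_rpow_const (p := 1 - (n : ℝ) / 2) (Or.inl hq.ne')).const_mul
    ((n : ℝ) ^ ((n : ℝ) / 2))
  rw [show (1 - (n : ℝ) / 2) - 1 = -(n : ℝ) / 2 by ring] at h
  exact h.add ((hasDerivAt_id q).div_const _)

theorem hasDerivAt_barrierProfileDeriv (hq : 0 < q) :
    HasDerivAt (barrierProfileDeriv n) (barrierProfileDeriv2 n q) q :=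
  (((Real.hasDerivAt_rpow_const (Or.inl hq.ne')).const_mul _).const_mul _).add_const _

theorem barrierProfile_laplacian (hn : n ≠ 0) (hq : 0 < q) :
    4 * q * barrierProfileDeriv2 n q + 2 * n * barrierProfileDeriv n q = 1 := by
  have h : q * q ^ (-(n : ℝ) / 2 - 1) = q ^ (-(n : ℝ) / 2) := by
    rw [Real.rpow_sub_one hq.ne']; field_simp
  have hn' : (n : ℝ) ≠ 0 := by exact_mod_cast hn
  have h2 : 2 * (n : ℝ) * (1 / (2 * n)) = 1 := by field_simp
  unfold barrierProfileDeriv barrierProfileDeriv2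
  rw [← h]
  linear_combination h2

theorem barrierProfileDeriv_nonpos (hn : 3 ≤ n) (hq : 0 < q) (hqn : q ≤ n) :
    barrierProfileDeriv n q ≤ 0 := by
  have hn' : (3 : ℝ) ≤ n := by exact_mod_cast hn
  have h1 : 1 ≤ (n : ℝ) ^ ((n : ℝ) / 2) * q ^ (-(n : ℝ) / 2) := by
    rw [neg_div, Real.rpow_neg hq.le, ← div_eq_mul_inv, one_le_div (by positivity)]
    exact Real.rpow_le_rpow hq.le hqn (by positivity)
  have h2 : 1 / (2 * (n : ℝ)) ≤ 1 / 2 :=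
    one_div_le_one_div_of_le (by norm_num) (by linarith)
  unfold barrierProfileDeriv
  nlinarith

theorem barrierProfile_le_of_le (hn : 3 ≤ n) {q₁ q₂ : ℝ} (h1 : 0 < q₁) (h12 : q₁ ≤ q₂)
    (h2 : q₂ ≤ n) : barrierProfile n q₂ ≤ barrierProfile n q₁ := by
  refine antitoneOn_of_deriv_nonpos (convex_Icc q₁ q₂) (fun q hq => ?_) (fun q hq => ?_)
    (fun q hq => ?_) (left_mem_Icc.2 h12) (right_mem_Icc.2 h12) h12
  · exact (hasDerivAt_barrierProfile (h1.trans_le hq.1)).continuousAt.continuousWithinAt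
  · rw [interior_Icc] at hq
    exact (hasDerivAt_barrierProfile
      (h1.trans hq.1)).differentiableAt.differentiableWithinAt
  · rw [interior_Icc] at hq
    rw [(hasDerivAt_barrierProfile (h1.trans hq.1)).deriv]
    exact barrierProfileDeriv_nonpos hn (h1.trans hq.1) (hq.2.le.trans h2)

theorem barrierProfile_nonneg (hq : 0 ≤ q) : 0 ≤ barrierProfile n q := by
  unfold barrierProfile; positivity

variable {v φ : EuclideanSpace ℝ (Fin n) → ℝ} {c κ r K : ℝ}

/-- The mollification of a weak supersolution of `Δv ≤ c`, minus a barrier of Laplacian `κ > c`,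
has no local minimum away from the origin. -/
theorem not_isLocalMin_mollify_sub_barrier (hn : n ≠ 0) (hv : Continuous v)
    (hw : LapLeWeak n univ v c) (hφ : ContDiff ℝ (⊤ : ℕ∞) φ) (hc : HasCompactSupport φ)
    (h0 : ∀ x, 0 ≤ φ x) (h1 : ∫ x, φ x = 1) (hcκ : c < κ) {x : EuclideanSpace ℝ (Fin n)}
    (hx : x ≠ 0) : ¬IsLocalMin (fun y => mollify v φ y - κ * barrierProfile n (‖y‖ ^ 2)) x := by
  intro hmin
  set s := ‖x‖ ^ 2 with hs
  have hs0 : 0 < s := by positivity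
  have key : ∀ i : Fin n, 0 ≤ mollify v (fun y => fderiv ℝ (fun z => fderiv ℝ φ z
      (EuclideanSpace.single i 1)) y (EuclideanSpace.single i 1)) x
      - κ * (4 * x i ^ 2 * barrierProfileDeriv2 n s + 2 * barrierProfileDeriv n s) := by
    intro i
    set e : EuclideanSpace ℝ (Fin n) := EuclideanSpace.single i 1
    have hq : ∀ t : ℝ, ‖x + t • e‖ ^ 2 = s + 2 * x i * t + t ^ 2 := by
      intro t
      rw [norm_add_sq_real, inner_smul_right, norm_smul]
      simp [e, EuclideanSpace.inner_single_right]
      ring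
    have hQ : ∀ t : ℝ, HasDerivAt (fun t : ℝ => s + 2 * x i * t + t ^ 2) (2 * x i + 2 * t) t := by
      intro t
      refine ((((hasDerivAt_id t).const_mul (2 * x i)).const_add s).add
        (hasDerivAt_pow 2 t)).congr_deriv ?_
      simp
    have hcont : Continuous fun t : ℝ => x + t • e := by fun_prop
    have hline : IsLocalMin (fun t : ℝ => mollify v φ (x + t • e)
        - κ * barrierProfile n (s + 2 * x i * t + t ^ 2)) 0 := by
      have htend : Filter.Tendsto (fun t : ℝ => x + t • e) (𝓝 0) (𝓝 x) := by
        simpa using hcont.tendsto 0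
      filter_upwards [htend.eventually hmin] with t ht
      simpa [hq] using ht
    have hpos : ∀ᶠ t : ℝ in 𝓝 0, 0 < s + 2 * x i * t + t ^ 2 := by
      refine (hQ 0).continuousAt.eventually_const_lt ?_
      simpa using hs0
    have hφ' := contDiff_fderiv_apply_const hφ e
    refine second_deriv_nonneg_of_isLocalMin hline
      (g' := fun t => mollify v (fun y => fderiv ℝ φ y e) (x + t • e)
        - κ * (barrierProfileDeriv n (s + 2 * x i * t + t ^ 2) * (2 * x i + 2 * t))) ?_ ?_
    · filter_upwards [hpos] with t ht
      exact (hasDerivAt_mollify_line hv (hφ.of_le (by simp)) hc x e t).sub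
        ((HasDerivAt.comp (h₂ := barrierProfile n) t (hasDerivAt_barrierProfile ht)
          (hQ t)).const_mul κ)
    · have hA := hasDerivAt_mollify_line hv (hφ'.of_le (by simp)) (hc.fderiv_apply ℝ e) x e 0
      have hlin : HasDerivAt (fun t : ℝ => 2 * x i + 2 * t) 2 0 := by
        simpa using ((hasDerivAt_id (0 : ℝ)).const_mul 2).const_add (2 * x i)
      have hB := (((hasDerivAt_barrierProfileDeriv (n := n) hpos.self_of_nhds).comp 0 (hQ 0)).mul
        hlin).const_mul κ
      refine (hA.sub hB).congr_deriv ?_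
      simp only [zero_smul, add_zero, mul_zero, Function.comp_apply, ne_eq, OfNat.ofNat_ne_zero,
        not_false_eq_true, zero_pow]
      ring
  have hsum := Finset.sum_nonneg fun i (_ : i ∈ Finset.univ) => key i
  have hle := sum_mollify_second_deriv_le hv hw hφ hc h0 h1 x
  have hnorm : ∑ i : Fin n, x i ^ 2 = s := by rw [hs, EuclideanSpace.real_norm_sq_eq]
  have hlap := barrierProfile_laplacian hn hs0
  rw [Finset.sum_sub_distrib, ← Finset.mul_sum, Finset.sum_add_distrib, ← Finset.sum_mul,
    ← Finset.mul_sum, hnorm] at hsum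
  simp only [Finset.sum_const, Finset.card_univ, Fintype.card_fin, nsmul_eq_mul] at hsum
  rw [show (n : ℝ) * (2 * barrierProfileDeriv n s) = 2 * n * barrierProfileDeriv n s by ring,
    hlap] at hsum
  linarith

theorem exists_int_translate_mem_cube (x : EuclideanSpace ℝ (Fin n)) :
    ∃ k : Fin n → ℤ, ∀ i, (x + (WithLp.equiv 2 (Fin n → ℝ)).symm (fun i => (k i : ℝ))) i
      = x i - round (x i) :=
  ⟨fun i => -round (x i), fun i => by simp [sub_eq_add_neg]⟩

theorem norm_le_norm_of_abs_le {x y : EuclideanSpace ℝ (Fin n)} (h : ∀ i, |x i| ≤ |y i|) :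
    ‖x‖ ≤ ‖y‖ := by
  rw [EuclideanSpace.norm_eq, EuclideanSpace.norm_eq]
  gcongr with i
  simpa using h i

theorem norm_sq_le_of_abs_le {x : EuclideanSpace ℝ (Fin n)} (h : ∀ i, |x i| ≤ 1 / 2) :
    ‖x‖ ^ 2 ≤ n / 4 := by
  rw [EuclideanSpace.real_norm_sq_eq]
  calc ∑ i, x i ^ 2 ≤ ∑ _i : Fin n, (1 / 4 : ℝ) := by
        refine Finset.sum_le_sum fun i _ => ?_
        have := abs_le.1 (h i)
        nlinarith
    _ = n / 4 := by simp; ring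

/-- A minimum over the unit cube minus a ball of a periodic function minus the barrier is a local
minimum, unless it is attained on the sphere. -/
theorem isLocalMin_of_isMinOn_cube {w : EuclideanSpace ℝ (Fin n) → ℝ} (hn : 3 ≤ n)
    (hper : IsZnPeriodic n w) (hκ : 0 ≤ κ) (hr : 0 < r) (hr4 : r ≤ 1 / 4)
    {x : EuclideanSpace ℝ (Fin n)} (hx : ∀ i, |x i| ≤ 1 / 2) (hrx : r < ‖x‖)
    (hmin : IsMinOn (fun y => w y - κ * barrierProfile n (‖y‖ ^ 2))
      {y | (∀ i, |y i| ≤ 1 / 2) ∧ r ≤ ‖y‖} x) :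
    IsLocalMin (fun y => w y - κ * barrierProfile n (‖y‖ ^ 2)) x := by
  have hn' : (3 : ℝ) ≤ n := by exact_mod_cast hn
  have e1 : ∀ᶠ y in 𝓝 x, r < ‖y‖ := continuous_norm.continuousAt.eventually_const_lt hrx
  have e2 : ∀ᶠ y in 𝓝 x, ‖y‖ ^ 2 < n := by
    have hcont : Continuous fun y : EuclideanSpace ℝ (Fin n) => ‖y‖ ^ 2 := by fun_prop
    exact hcont.continuousAt.eventually_lt_const
      (by have := norm_sq_le_of_abs_le hx; linarith)
  have e3 : ∀ᶠ y in 𝓝 x, ∀ i, |y i| < 5 / 8 := by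
    rw [Filter.eventually_all]
    intro i
    have : Continuous fun y : EuclideanSpace ℝ (Fin n) => |y i| := by fun_prop
    exact this.continuousAt.eventually_lt_const (by linarith [hx i])
  filter_upwards [e1, e2, e3] with y hy1 hy2 hy3
  obtain ⟨k, hk⟩ := exists_int_translate_mem_cube y
  have hpy := hper y k
  set z := y + (WithLp.equiv 2 (Fin n → ℝ)).symm (fun i => (k i : ℝ))
  have hzy : ‖z‖ ≤ ‖y‖ := norm_le_norm_of_abs_le fun i => by
    rw [hk]; simpa using round_le (y i) 0
  have hrz : r ≤ ‖z‖ := by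
    by_cases hall : ∀ i, round (y i) = 0
    · have : z = y := by ext i; rw [hk, hall]; simp
      rw [this]; exact hy1.le
    · push Not at hall
      obtain ⟨i, hi⟩ := hall
      have h1 : (1 : ℝ) ≤ |(round (y i) : ℝ)| := by
        exact_mod_cast Int.one_le_abs hi
      have h2 : |z i| ≤ ‖z‖ := by simpa using PiLp.norm_apply_le z i
      have h3 : |(round (y i) : ℝ)| - |y i| ≤ |z i| := by
        rw [hk, abs_sub_comm]; exact abs_sub_abs_le_abs_sub _ _
      linarith [hy3 i]
  have hmz := isMinOn_iff.1 hmin z (show z ∈ _ from ⟨fun i => by rw [hk]; exact abs_sub_round _, hrz⟩)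
  have hb : barrierProfile n (‖y‖ ^ 2) ≤ barrierProfile n (‖z‖ ^ 2) :=
    barrierProfile_le_of_le hn (by have := hr.trans_le hrz; positivity) (by gcongr) hy2.le
  have := mul_le_mul_of_nonneg_left hb hκ
  rw [hpy] at hmz
  linarith

/-- A mollified periodic weak supersolution of `Δv ≤ c` bounded below by `-K` on the ball of radius
`r` is bounded below everywhere by `-K` minus the barrier at radius `r`. -/
theorem mollify_ge_of_ge_on_ball (hn : 3 ≤ n) (hv : Continuous v) (hper : IsZnPeriodic n v)
    (hw : LapLeWeak n univ v c) (hφ : ContDiff ℝ (⊤ : ℕ∞) φ) (hc : HasCompactSupport φ)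
    (h0 : ∀ x, 0 ≤ φ x) (h1 : ∫ x, φ x = 1) (hκ : 0 ≤ κ) (hcκ : c < κ) (hr : 0 < r)
    (hr4 : r ≤ 1 / 4) (hK : ∀ x, ‖x‖ ≤ r → -K ≤ mollify v φ x) (x : EuclideanSpace ℝ (Fin n)) :
    -K - κ * barrierProfile n (r ^ 2) ≤ mollify v φ x := by
  have hwc := continuous_mollify hv hφ.continuous hc
  have hwp : IsZnPeriodic n (mollify v φ) := mollify_periodic hper
  have hbr : 0 ≤ κ * barrierProfile n (r ^ 2) := mul_nonneg hκ (barrierProfile_nonneg (sq_nonneg r))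
  obtain ⟨k, hk⟩ := exists_int_translate_mem_cube x
  rw [← hwp x k]
  set z := x + (WithLp.equiv 2 (Fin n → ℝ)).symm (fun i => (k i : ℝ))
  rcases le_total ‖z‖ r with hz | hz
  · linarith [hK z hz]
  let D : Set (EuclideanSpace ℝ (Fin n)) := {y | (∀ i, |y i| ≤ 1 / 2) ∧ r ≤ ‖y‖}
  have hzD : z ∈ D := ⟨fun i => by rw [hk]; exact abs_sub_round _, hz⟩
  have hDc : IsCompact D := by
    refine Metric.isCompact_of_isClosed_isBounded ?_ ?_
    · have : D = (⋂ i, {y | |y i| ≤ 1 / 2}) ∩ {y | r ≤ ‖y‖} := by ext; simp [D]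
      rw [this]
      exact (isClosed_iInter fun i => isClosed_le (by fun_prop) continuous_const).inter
        (isClosed_le continuous_const continuous_norm)
    · refine (Metric.isBounded_closedBall (x := 0) (r := √(n / 4))).subset fun y hy => ?_
      rw [mem_closedBall_zero_iff]
      exact Real.le_sqrt_of_sq_le (norm_sq_le_of_abs_le hy.1)
  have hcont : ContinuousOn (fun y => mollify v φ y - κ * barrierProfile n (‖y‖ ^ 2)) D := by
    intro y hy
    have hy0 : 0 < ‖y‖ := hr.trans_le hy.2
    have hp : ContinuousAt (fun y : EuclideanSpace ℝ (Fin n) => barrierProfile n (‖y‖ ^ 2)) y :=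
      ContinuousAt.comp (f := fun y : EuclideanSpace ℝ (Fin n) => ‖y‖ ^ 2)
        (hasDerivAt_barrierProfile (by positivity)).continuousAt (by fun_prop)
    exact (hwc.continuousAt.sub (continuousAt_const.mul hp)).continuousWithinAt
  obtain ⟨y, hyD, hy⟩ := hDc.exists_isMinOn ⟨z, hzD⟩ hcont
  have hyr : ‖y‖ = r := by
    refine le_antisymm (not_lt.1 fun hlt => ?_) hyD.2
    exact not_isLocalMin_mollify_sub_barrier (by omega) hv hw hφ hc h0 h1 hcκ
      (norm_pos_iff.1 (hr.trans hlt)) (isLocalMin_of_isMinOn_cube hn hwp hκ hr hr4 hyD.1 hlt hy)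
  have hyz := isMinOn_iff.1 hy z hzD
  rw [hyr] at hyz
  have := hK y hyr.le
  have := mul_nonneg hκ (barrierProfile_nonneg (n := n) (sq_nonneg ‖z‖))
  linarith

end Barrier

/-- **Corrector height bound in dimension `n ≥ 3`, quadratic obstacle.**  If
`ψ : ℝⁿ → ℝ` is continuous, `ℤⁿ`-periodic, nonpositive, with `ψ(0) = 0` and
`ψ(x) ≥ -B|x|²` for `|x| ≤ 1/2`, then any continuous `ℤⁿ`-periodic `v ≥ ψ`
with `Δv ≤ μ` weakly satisfies `v ≥ -C μ^{2/n}`, with `C = C(n, B)`. -/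
theorem corrector_bound_quadratic (n : ℕ) (hn : 3 ≤ n) (B : ℝ) (hB : 0 < B) :
    ∃ C > 0, ∀ ψ : EuclideanSpace ℝ (Fin n) → ℝ,
      Continuous ψ → IsZnPeriodic n ψ → (∀ x, ψ x ≤ 0) → ψ 0 = 0 →
      (∀ x : EuclideanSpace ℝ (Fin n), ‖x‖ ≤ 1/2 → -(B * ‖x‖ ^ 2) ≤ ψ x) →
      ∀ μ ∈ Set.Ioc (0:ℝ) 1, ∀ v : EuclideanSpace ℝ (Fin n) → ℝ,
        Continuous v → IsZnPeriodic n v → (∀ x, ψ x ≤ v x) →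
        LapLeWeak n Set.univ v μ →
        ∀ x, -(C * μ ^ ((2:ℝ) / n)) ≤ v x := by
  have hn' : (3 : ℝ) ≤ n := by exact_mod_cast hn
  set A : ℝ := (n : ℝ) ^ ((n : ℝ) / 2) with hA
  have hA0 : 0 < A := by positivity
  refine ⟨B / 4 + 2 * (A * 4 ^ (n - 2) + 1), by positivity, ?_⟩
  intro ψ _ _ _ _ hψB μ hμ v hv hper hψv hw x
  obtain ⟨hμ0, hμ1⟩ := hμ
  set m : ℝ := μ ^ ((2 : ℝ) / n) with hm
  set ρ : ℝ := μ ^ ((1 : ℝ) / n) with hρ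
  have hρ0 : 0 < ρ := by positivity
  have hρ1 : ρ ≤ 1 := Real.rpow_le_one hμ0.le hμ1 (by positivity)
  have hρm : ρ ^ 2 = m := by
    rw [hρ, hm, ← Real.rpow_mul_natCast hμ0.le]; congr 1; push_cast; ring
  have hμρ : μ = ρ ^ n := by
    rw [hρ, ← Real.rpow_mul_natCast hμ0.le, one_div_mul_cancel (by positivity), Real.rpow_one]
  set r : ℝ := ρ / 4 with hr
  have hr0 : 0 < r := by positivity
  have hr4 : r ≤ 1 / 4 := by rw [hr]; linarith
  have hbar : μ * barrierProfile n (r ^ 2) ≤ (A * 4 ^ (n - 2) + 1) * m := by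
    have h1 : (r ^ 2) ^ (1 - (n : ℝ) / 2) = (r ^ (n - 2))⁻¹ := by
      rw [← Real.rpow_natCast, ← Real.rpow_mul hr0.le, ← Real.rpow_natCast, ← Real.rpow_neg hr0.le,
        Nat.cast_sub (by omega)]
      congr 1; push_cast; ring
    have h2 : μ * (r ^ (n - 2))⁻¹ = 4 ^ (n - 2) * m := by
      rw [hμρ, ← hρm, hr, div_pow, inv_div]
      obtain ⟨k, rfl⟩ : ∃ k, n = k + 2 := ⟨n - 2, by omega⟩
      rw [Nat.add_sub_cancel, pow_add]
      field_simp
    have h3 : μ * (r ^ 2 / (2 * n)) ≤ m := by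
      rw [← hρm]
      have h4 : r ^ 2 / (2 * n) ≤ r ^ 2 := div_le_self (by positivity) (by linarith)
      calc μ * (r ^ 2 / (2 * n)) ≤ 1 * r ^ 2 := by gcongr
        _ ≤ ρ ^ 2 := by rw [hr]; nlinarith
    rw [barrierProfile, h1]
    linear_combination A * h2 + h3
  refine le_of_forall_pos_le_add fun δ hδ => ?_
  obtain ⟨η, hη, hηv⟩ := Metric.continuous_iff.1 hv x δ hδ
  obtain ⟨φ, hφ, hc, h0, h1, hsupp⟩ := exists_mollifier n (lt_min hη hr0)
  have hK : ∀ y, ‖y‖ ≤ r → -(B * (2 * r) ^ 2) ≤ mollify v φ y := by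
    refine fun y hy => le_mollify hv hφ.continuous hc h0 h1 hsupp fun z hz => ?_
    have hz' : ‖z‖ ≤ 2 * r := by
      have := norm_sub_norm_le z y
      rw [norm_sub_rev] at this
      linarith [hz.trans_le (min_le_right _ _)]
    refine le_trans ?_ ((hψB z (by linarith)).trans (hψv z))
    gcongr
  have hlow := mollify_ge_of_ge_on_ball hn hv hper hw hφ hc h0 h1 (κ := 2 * μ) (by positivity)
    (by linarith) hr0 hr4 hK x
  have hup : mollify v φ x ≤ v x + δ := by
    refine mollify_le hv hφ.continuous hc h0 h1 hsupp fun y hy => ?_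
    have h := hηv y (by rw [dist_comm, dist_eq_norm]; exact hy.trans_le (min_le_left _ _))
    rw [Real.dist_eq] at h
    linarith [(abs_lt.1 h).2]
  have hBr : B * (2 * r) ^ 2 = B / 4 * m := by rw [hr, ← hρm]; ring
  linarith
end

section
/- Let U ⊂ ℝⁿ be a bounded open set, λ ∈ (0,1], p ∈ ℝ, ε > 0, and set μ := λ⁻¹ ε^{2−p}. Let ψ : ℝⁿ → ℝ be continuous and ℤⁿ-periodic, and let χ : ℝⁿ → ℝ be continuous and ℤⁿ-periodic with ψ ≤ χ ≤ 0 on ℝⁿ and Δχ = μ weakly in the open set {x ∈ ℝⁿ : χ(x) > ψ(x)}. Let w : cl(U) → ℝ be continuous with Δw ≤ λ⁻¹ weakly in U, w(x) ≥ ε^p ψ(x/ε) for all x ∈ U, and w(x) > 0 for all x ∈ ∂U. Then w(x) ≥ ε^p χ(x/ε) for all x ∈ U. -/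
open MeasureTheory Metric Set Bornology

/-- `Δw = c` weakly in `V`. -/
def LapEqWeak (n : ℕ) (V : Set (EuclideanSpace ℝ (Fin n)))
    (w : EuclideanSpace ℝ (Fin n) → ℝ) (c : ℝ) : Prop :=
  ∀ φ : EuclideanSpace ℝ (Fin n) → ℝ, ContDiff ℝ (⊤ : ℕ∞) φ → HasCompactSupport φ →
    tsupport φ ⊆ V → (∀ x, 0 ≤ φ x) →
    ∫ x in V, w x * lapl n φ x = c * ∫ x in V, φ x

lemma fderiv_comp_affine {E : Type*} [NormedAddCommGroup E] [NormedSpace ℝ E] {f : E → ℝ}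
    (hf : Differentiable ℝ f) (c : ℝ) (b x v : E) :
    fderiv ℝ (fun y => f (c • y + b)) x v = c * fderiv ℝ f (c • x + b) v := by
  have h : HasFDerivAt (fun y : E => c • y + b) (c • ContinuousLinearMap.id ℝ E) x :=
    ((hasFDerivAt_id x).const_smul c).add_const b
  have h2 := (hf (c • x + b)).hasFDerivAt.comp x h
  rw [show (fun y => f (c • y + b)) = f ∘ (fun y : E => c • y + b) from rfl, h2.fderiv]
  simp

lemma contDiff_fderiv_apply_const_s5 {E : Type*} [NormedAddCommGroup E] [NormedSpace ℝ E] {f : E → ℝ}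
    (hf : ContDiff ℝ (⊤ : ℕ∞) f) (v : E) :
    ContDiff ℝ (⊤ : ℕ∞) (fun y => fderiv ℝ f y v) :=
  (hf.fderiv_right (by simp)).clm_apply contDiff_const

lemma differentiable_of_contDiff_top {E : Type*} [NormedAddCommGroup E] [NormedSpace ℝ E]
    {f : E → ℝ} (hf : ContDiff ℝ (⊤ : ℕ∞) f) : Differentiable ℝ f :=
  hf.differentiable (by simp)

lemma lapl_comp_affine {n : ℕ} {f : EuclideanSpace ℝ (Fin n) → ℝ} (hf : ContDiff ℝ (⊤ : ℕ∞) f)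
    (c : ℝ) (b x : EuclideanSpace ℝ (Fin n)) :
    lapl n (fun y => f (c • y + b)) x = c ^ 2 * lapl n f (c • x + b) := by
  unfold lapl
  rw [Finset.mul_sum]
  refine Finset.sum_congr rfl fun i _ => ?_
  have hd := differentiable_of_contDiff_top
    (contDiff_fderiv_apply_const_s5 hf (EuclideanSpace.single i 1))
  simp_rw [fderiv_comp_affine (differentiable_of_contDiff_top hf)]
  rw [fderiv_const_mul]
  · rw [smul_apply, fderiv_comp_affine hd]
    simp only [smul_eq_mul]
    ring
  · exact (hd _).comp x (by fun_prop)

lemma continuous_lapl {n : ℕ} {f : EuclideanSpace ℝ (Fin n) → ℝ} (hf : ContDiff ℝ (⊤ : ℕ∞) f) :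
    Continuous (lapl n f) := by
  unfold lapl
  exact continuous_finsetSum _ fun i _ =>
    (contDiff_fderiv_apply_const_s5 (contDiff_fderiv_apply_const_s5 hf _) _).continuous

lemma lapl_eq_zero_of_notMem_tsupport {n : ℕ} {f : EuclideanSpace ℝ (Fin n) → ℝ}
    {x : EuclideanSpace ℝ (Fin n)} (hx : x ∉ tsupport f) : lapl n f x = 0 := by
  unfold lapl
  refine Finset.sum_eq_zero fun i _ => ?_
  set e : EuclideanSpace ℝ (Fin n) := EuclideanSpace.single i 1
  have h1 : tsupport (fun y => fderiv ℝ f y e) ⊆ tsupport f := tsupport_fderiv_apply_subset ℝ e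
  have h2 : tsupport (fun y => fderiv ℝ (fun z => fderiv ℝ f z e) y e) ⊆ tsupport f :=
    (tsupport_fderiv_apply_subset ℝ e).trans h1
  exact image_eq_zero_of_notMem_tsupport
    (f := fun y => fderiv ℝ (fun z => fderiv ℝ f z e) y e) fun h => hx (h2 h)

lemma lapl_add {n : ℕ} {f g : EuclideanSpace ℝ (Fin n) → ℝ} (hf : ContDiff ℝ (⊤ : ℕ∞) f)
    (hg : ContDiff ℝ (⊤ : ℕ∞) g) (x : EuclideanSpace ℝ (Fin n)) :
    lapl n (fun y => f y + g y) x = lapl n f x + lapl n g x := by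
  unfold lapl
  rw [← Finset.sum_add_distrib]
  refine Finset.sum_congr rfl fun i _ => ?_
  have h : ∀ y, fderiv ℝ (fun y => f y + g y) y = fderiv ℝ f y + fderiv ℝ g y := fun y =>
    fderiv_fun_add (differentiable_of_contDiff_top hf y) (differentiable_of_contDiff_top hg y)
  simp_rw [h, add_apply]
  rw [fderiv_fun_add
    (differentiable_of_contDiff_top (contDiff_fderiv_apply_const_s5 hf _) x)
    (differentiable_of_contDiff_top (contDiff_fderiv_apply_const_s5 hg _) x)]
  rfl

lemma lapl_mul_norm_sq {n : ℕ} (δ : ℝ) (x : EuclideanSpace ℝ (Fin n)) :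
    lapl n (fun y => δ * ‖y‖ ^ 2) x = 2 * n * δ := by
  unfold lapl
  have h1 : ∀ (y : EuclideanSpace ℝ (Fin n)) (i : Fin n),
      fderiv ℝ (fun y : EuclideanSpace ℝ (Fin n) => δ * ‖y‖ ^ 2) y (EuclideanSpace.single i 1)
        = (2 * δ) * EuclideanSpace.proj (𝕜 := ℝ) i y := by
    intro y i
    have := ((hasStrictFDerivAt_norm_sq y).hasFDerivAt.const_mul δ).fderiv
    rw [this]
    simp [EuclideanSpace.inner_single_right]
    ring
  simp_rw [h1]
  have h2 : ∀ i : Fin n, fderiv ℝ (fun y : EuclideanSpace ℝ (Fin n) =>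
      (2 * δ) * EuclideanSpace.proj (𝕜 := ℝ) i y) x (EuclideanSpace.single i 1) = 2 * δ := by
    intro i
    rw [((EuclideanSpace.proj (𝕜 := ℝ) i).hasFDerivAt.const_mul (2 * δ)).fderiv]
    simp
  simp_rw [h2]
  simp
  ring

lemma IsLocalMax.fderiv_fderiv_apply_nonpos {E : Type*} [NormedAddCommGroup E] [NormedSpace ℝ E]
    {G : E → ℝ} (hG : ContDiff ℝ (⊤ : ℕ∞) G) {b : E} (hb : IsLocalMax G b) (e : E) :
    fderiv ℝ (fun y => fderiv ℝ G y e) b e ≤ 0 := by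
  by_contra! hpos
  have key : ∀ {f : E → ℝ}, Differentiable ℝ f → ∀ t : ℝ,
      HasDerivAt (fun s : ℝ => f (b + s • e)) (fderiv ℝ f (b + t • e) e) t := by
    intro f hf t
    have h : HasDerivAt (fun s : ℝ => b + s • e) e t := by
      simpa using ((hasDerivAt_id t).smul_const e).const_add b
    exact (hf _).hasFDerivAt.comp_hasDerivAt t h
  set u : ℝ → ℝ := fun s => G (b + s • e) with hu
  have hd : deriv u = fun t => fderiv ℝ G (b + t • e) e :=
    funext fun t => (key (differentiable_of_contDiff_top hG) t).deriv
  have hdd : deriv (deriv u) 0 = fderiv ℝ (fun y => fderiv ℝ G y e) b e := by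
    rw [hd]
    simpa using
      (key (differentiable_of_contDiff_top (contDiff_fderiv_apply_const_s5 hG e)) 0).deriv
  have hline : Filter.Tendsto (fun s : ℝ => b + s • e) (nhds 0) (nhds b) := by
    have : Continuous (fun s : ℝ => b + s • e) := by fun_prop
    simpa using this.tendsto 0
  have hmax : IsLocalMax u 0 := by
    have := hline.eventually hb
    simpa [IsLocalMax, IsMaxFilter, hu] using this
  have hmin : IsLocalMin u 0 :=
    isLocalMin_of_deriv_deriv_pos (by rw [hdd]; exact hpos) hmax.deriv_eq_zero
      (key (differentiable_of_contDiff_top hG) 0).continuousAt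
  have hconst : u =ᶠ[nhds 0] fun _ => u 0 := by
    filter_upwards [hmax, hmin] with t h1 h2 using le_antisymm h1 h2
  have : deriv (deriv u) 0 = 0 := by
    rw [hconst.deriv.deriv_eq]
    simp
  linarith

lemma lapl_nonpos_of_isLocalMax {n : ℕ} {G : EuclideanSpace ℝ (Fin n) → ℝ}
    (hG : ContDiff ℝ (⊤ : ℕ∞) G) {b : EuclideanSpace ℝ (Fin n)} (hb : IsLocalMax G b) :
    lapl n G b ≤ 0 :=
  Finset.sum_nonpos fun _ _ => hb.fderiv_fderiv_apply_nonpos hG _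

open ContinuousLinearMap Convolution in
lemma fderiv_convolution_apply {n : ℕ} {g ρ : EuclideanSpace ℝ (Fin n) → ℝ}
    (hg : LocallyIntegrable g volume) (hρ : ContDiff ℝ (⊤ : ℕ∞) ρ) (hρc : HasCompactSupport ρ)
    (x e : EuclideanSpace ℝ (Fin n)) :
    fderiv ℝ (g ⋆[lsmul ℝ ℝ, volume] ρ) x e
      = (g ⋆[lsmul ℝ ℝ, volume] (fun y => fderiv ℝ ρ y e)) x := by
  rw [(hρc.hasFDerivAt_convolution_right (lsmul ℝ ℝ) hg (hρ.of_le (by simp)) x).fderiv,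
    convolution_precompR_apply (lsmul ℝ ℝ) hg (hρc.fderiv ℝ) (hρ.continuous_fderiv (by simp))]

open ContinuousLinearMap Convolution in
lemma lapl_convolution {n : ℕ} {g ρ : EuclideanSpace ℝ (Fin n) → ℝ}
    (hg : LocallyIntegrable g volume) (hρ : ContDiff ℝ (⊤ : ℕ∞) ρ) (hρc : HasCompactSupport ρ)
    (x : EuclideanSpace ℝ (Fin n)) :
    lapl n (g ⋆[lsmul ℝ ℝ, volume] ρ) x = ∫ t, g t * lapl n ρ (x - t) := by
  have hc : ∀ e : EuclideanSpace ℝ (Fin n), HasCompactSupport fun y => fderiv ℝ ρ y e :=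
    fun e => hρc.fderiv_apply ℝ e
  have hs : ∀ e : EuclideanSpace ℝ (Fin n), ContDiff ℝ (⊤ : ℕ∞) fun y => fderiv ℝ ρ y e :=
    fun e => contDiff_fderiv_apply_const_s5 hρ e
  unfold lapl
  simp_rw [fderiv_convolution_apply hg hρ hρc, Finset.mul_sum]
  rw [integral_finsetSum]
  · refine Finset.sum_congr rfl fun i _ => ?_
    exact fderiv_convolution_apply hg (hs _) (hc _) x _
  · intro i _
    exact ((hc _).fderiv_apply ℝ _).convolutionExists_right (lsmul ℝ ℝ) hg
      (contDiff_fderiv_apply_const_s5 (hs _) _).continuous x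

open ContinuousLinearMap Convolution in
/-- Maximum principle for continuous weakly subharmonic functions. -/
lemma le_of_weakly_subharmonic {n : ℕ} (hn : 0 < n) {V K : Set (EuclideanSpace ℝ (Fin n))}
    (hV : IsOpen V) (hK : IsCompact K) (hKV : K ⊆ V) {g : EuclideanSpace ℝ (Fin n) → ℝ}
    (hgi : LocallyIntegrable g volume) (hgc : ContinuousOn g V)
    (hsub : ∀ φ : EuclideanSpace ℝ (Fin n) → ℝ, ContDiff ℝ (⊤ : ℕ∞) φ → HasCompactSupport φ →
      tsupport φ ⊆ V → (∀ x, 0 ≤ φ x) → 0 ≤ ∫ x, g x * lapl n φ x)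
    {c : ℝ} (hc : ∀ x ∈ K \ interior K, g x ≤ c) : ∀ x ∈ K, g x ≤ c := by
  intro a ha
  by_contra! hca
  set m := g a - c with hm
  have hm0 : 0 < m := sub_pos.2 hca
  obtain ⟨R, hR⟩ := hK.isBounded.exists_norm_le
  obtain ⟨r, hr0, hrV⟩ := hK.exists_cthickening_subset_open hV hKV
  have hthick : IsCompact (cthickening r K) := hK.cthickening
  obtain ⟨s, hs0, hs⟩ := Metric.uniformContinuousOn_iff.1
    (hthick.uniformContinuousOn_of_continuous (hgc.mono hrV)) (m / 4) (by positivity)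
  set q := min r s with hq
  have hq0 : 0 < q := lt_min hr0 hs0
  let β : ContDiffBump (0 : EuclideanSpace ℝ (Fin n)) :=
    ⟨q / 2, q, by positivity, by linarith⟩
  set ρ := β.normed volume with hρdef
  have hρ : ContDiff ℝ (⊤ : ℕ∞) ρ := β.contDiff_normed
  have hρc : HasCompactSupport ρ := β.hasCompactSupport_normed
  set F := g ⋆[lsmul ℝ ℝ, volume] ρ with hF
  have hball : ∀ x ∈ K, closedBall x r ⊆ cthickening r K := fun x hx =>
    closedBall_subset_cthickening hx r
  have hFg : ∀ x ∈ K, dist (F x) (g x) ≤ m / 4 := by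
    intro x hx
    have hswap : F x = (ρ ⋆[lsmul ℝ ℝ, volume] g) x := by
      rw [convolution_lsmul_swap, hF, convolution_def]
      simp [mul_comm]
    rw [hswap]
    refine β.dist_normed_convolution_le hgi.aestronglyMeasurable fun y hy => ?_
    have hyq : dist y x < q := hy
    exact (hs y (hball x hx (mem_closedBall.2 (hyq.le.trans (min_le_left _ _)))) x
      (self_subset_cthickening _ hx) (hyq.trans_le (min_le_right _ _))).le
  have hFs : ContDiff ℝ (⊤ : ℕ∞) F := hρc.contDiff_convolution_right _ hgi hρ
  have hlapF : ∀ x ∈ K, 0 ≤ lapl n F x := by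
    intro x hx
    rw [hF, lapl_convolution hgi hρ hρc]
    have hφ : ContDiff ℝ (⊤ : ℕ∞) fun t => ρ ((-1 : ℝ) • t + x) :=
      hρ.comp (by fun_prop)
    have hsupp : tsupport (fun t => ρ ((-1 : ℝ) • t + x)) ⊆ closedBall x q := by
      refine closure_minimal (fun t ht => ?_) isClosed_closedBall
      have h : (-1 : ℝ) • t + x ∈ Function.support ρ := ht
      rw [hρdef, β.support_normed_eq, mem_ball, dist_zero_right] at h
      rw [mem_closedBall, dist_comm, dist_eq_norm]
      have h' : ‖(-1 : ℝ) • t + x‖ < q := h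
      rw [show (-1 : ℝ) • t + x = x - t by rw [neg_one_smul]; abel] at h'
      exact h'.le
    have := hsub _ hφ (HasCompactSupport.of_support_subset_isCompact (isCompact_closedBall x q)
      (subset_tsupport _ |>.trans hsupp))
      (hsupp.trans ((closedBall_subset_closedBall (min_le_left _ _)).trans
        ((hball x hx).trans hrV))) (fun t => β.nonneg_normed _)
    refine this.trans_eq (integral_congr_ae (Filter.Eventually.of_forall fun t => ?_))
    simp only [lapl_comp_affine hρ]
    rw [show (-1 : ℝ) • t + x = x - t by rw [neg_one_smul]; abel]
    ring
  set δ := m / (4 * (R ^ 2 + 1)) with hδ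
  have hδ0 : 0 < δ := by positivity
  have hδR : δ * R ^ 2 < m / 4 := by
    rw [hδ, div_mul_eq_mul_div, div_lt_iff₀ (by positivity)]
    nlinarith
  have hN : ContDiff ℝ (⊤ : ℕ∞) fun y : EuclideanSpace ℝ (Fin n) => δ * ‖y‖ ^ 2 :=
    contDiff_const.mul (contDiff_norm_sq ℝ)
  set G : EuclideanSpace ℝ (Fin n) → ℝ := fun y => F y + δ * ‖y‖ ^ 2 with hG
  have hGs : ContDiff ℝ (⊤ : ℕ∞) G := hFs.add hN
  obtain ⟨b, hbK, hb⟩ := hK.exists_isMaxOn ⟨a, ha⟩ hGs.continuous.continuousOn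
  have hbint : b ∈ interior K := by
    by_contra hbi
    have h1 := hc b ⟨hbK, hbi⟩
    have h2 := abs_le.1 (Real.dist_eq _ _ ▸ hFg b hbK)
    have h3 := abs_le.1 (Real.dist_eq _ _ ▸ hFg a ha)
    have h4 : F a + δ * ‖a‖ ^ 2 ≤ F b + δ * ‖b‖ ^ 2 := hb ha
    have h5 : δ * ‖b‖ ^ 2 ≤ δ * R ^ 2 := by
      gcongr
      exact hR b hbK
    have h6 : 0 ≤ δ * ‖a‖ ^ 2 := by positivity
    linarith [h2.2, h3.1]
  have hloc : IsLocalMax G b := hb.isLocalMax (mem_interior_iff_mem_nhds.1 hbint)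
  have h1 := lapl_nonpos_of_isLocalMax hGs hloc
  rw [hG, lapl_add hFs hN, lapl_mul_norm_sq] at h1
  have h2 := hlapF b hbK
  have h3 : (0 : ℝ) < 2 * n * δ := by positivity
  linarith

/-- The weak equation `Δχ = μ` rescales to `Δ(ε^p χ(·/ε)) = ε^{p-2} μ`. -/
lemma LapEqWeak.integral_rescale {n : ℕ} {W : Set (EuclideanSpace ℝ (Fin n))}
    {χ : EuclideanSpace ℝ (Fin n) → ℝ} {μ : ℝ} (h : LapEqWeak n W χ μ) {ε : ℝ} (hε : 0 < ε)
    (p : ℝ) {φ : EuclideanSpace ℝ (Fin n) → ℝ} (hφ : ContDiff ℝ (⊤ : ℕ∞) φ)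
    (hφc : HasCompactSupport φ) (hφW : ∀ x ∈ tsupport φ, ε⁻¹ • x ∈ W) (hφ0 : ∀ x, 0 ≤ φ x) :
    ∫ x, ε ^ p * χ (ε⁻¹ • x) * lapl n φ x = ε ^ (p - 2) * μ * ∫ x, φ x := by
  have hcont : Continuous fun y : EuclideanSpace ℝ (Fin n) => ε • y + 0 := by fun_prop
  have hcts : tsupport (fun y => φ (ε • y + 0)) ⊆ (fun y => ε • y + 0) ⁻¹' tsupport φ :=
    tsupport_comp_subset_preimage φ hcont
  have hcomp : HasCompactSupport fun y => φ (ε • y + 0) := by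
    have := hφc.comp_homeomorph (Homeomorph.smulOfNeZero ε hε.ne')
    simpa [Function.comp_def] using this
  have hsW : tsupport (fun y => φ (ε • y + 0)) ⊆ W := fun y hy => by
    have := hφW _ (hcts hy)
    simpa [smul_smul, inv_mul_cancel₀ hε.ne'] using this
  have key := h (fun y => φ (ε • y + 0)) (hφ.comp (by fun_prop)) hcomp hsW fun _ => hφ0 _
  rw [setIntegral_eq_integral_of_forall_compl_eq_zero,
    setIntegral_eq_integral_of_forall_compl_eq_zero] at key
  rotate_left
  · exact fun x hx => image_eq_zero_of_notMem_tsupport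
      (f := fun y => φ (ε • y + 0)) fun hx' => hx (hsW hx')
  · exact fun x hx => by rw [lapl_eq_zero_of_notMem_tsupport fun hx' => hx (hsW hx'), mul_zero]
  simp only [lapl_comp_affine hφ] at key
  simp only [add_zero] at key
  have e1 := Measure.integral_comp_smul (volume : Measure (EuclideanSpace ℝ (Fin n)))
    (fun x => χ (ε⁻¹ • x) * lapl n φ x) ε
  have e2 := Measure.integral_comp_smul (volume : Measure (EuclideanSpace ℝ (Fin n))) φ ε
  simp only [smul_smul, inv_mul_cancel₀ hε.ne', one_smul] at e1
  have e3 : ∫ x, χ x * (ε ^ 2 * lapl n φ (ε • x)) = ε ^ 2 * ∫ x, χ x * lapl n φ (ε • x) := by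
    rw [← integral_const_mul]
    congr 1
    ext x
    ring
  rw [e3, e1, e2] at key
  simp only [smul_eq_mul] at key
  have hc : 0 < |(ε ^ Module.finrank ℝ (EuclideanSpace ℝ (Fin n)))⁻¹| := by positivity
  have key2 : ε ^ 2 * ∫ x, χ (ε⁻¹ • x) * lapl n φ x = μ * ∫ x, φ x :=
    mul_left_cancel₀ hc.ne' (by linear_combination key)
  have hpow : ε ^ p = ε ^ (p - 2) * ε ^ 2 := by
    rw [← Real.rpow_natCast, ← Real.rpow_add hε]
    norm_num
  simp_rw [mul_assoc]
  rw [integral_const_mul, hpow, mul_assoc, key2]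

/-- In dimension zero the non-contact set of the corrector is empty. -/
lemma LapEqWeak.eq_empty_of_dim_zero {W : Set (EuclideanSpace ℝ (Fin 0))}
    {χ : EuclideanSpace ℝ (Fin 0) → ℝ} {μ : ℝ} (hμ : μ ≠ 0) (h : LapEqWeak 0 W χ μ) : W = ∅ := by
  by_contra hW
  have hWu : W = univ :=
    Subsingleton.eq_univ_of_nonempty (Set.nonempty_iff_ne_empty.2 hW)
  subst hWu
  have := h (fun _ => 1) contDiff_const
    (HasCompactSupport.of_support_subset_isCompact
      (Set.subsingleton_of_subsingleton.isCompact (s := univ)) (subset_univ _))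
    (subset_univ _) (fun _ => zero_le_one)
  have hvol : volume.real (univ : Set (EuclideanSpace ℝ (Fin 0))) ≠ 0 :=
    ENNReal.toReal_ne_zero.2 ⟨isOpen_univ.measure_ne_zero _ univ_nonempty,
      (Set.subsingleton_of_subsingleton.isCompact (s := univ)).measure_ne_top⟩
  simp [lapl, hμ, hvol] at this

/-- **Corrector comparison (Lemma 3.1).**  If `χ` is a periodic function with
`ψ ≤ χ ≤ 0` and `Δχ = μ = λ⁻¹ε^{2-p}` weakly on its non-contact set `{χ > ψ}`, and
`w` is continuous on `cl(U)`, satisfies `Δw ≤ λ⁻¹` weakly in `U`, `w ≥ ε^p ψ(·/ε)`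
in `U` and `w > 0` on `∂U`, then `w ≥ ε^p χ(·/ε)` in `U`. -/
theorem height_above_corrector (n : ℕ) (U : Set (EuclideanSpace ℝ (Fin n)))
    (hUo : IsOpen U) (hUb : IsBounded U)
    (lam p ε μ : ℝ) (hlam : lam ∈ Set.Ioc (0:ℝ) 1) (hε : 0 < ε)
    (hμ : μ = lam⁻¹ * ε ^ (2 - p))
    (ψ χ : EuclideanSpace ℝ (Fin n) → ℝ)
    (hψc : Continuous ψ) (hψper : IsZnPeriodic n ψ)
    (hχc : Continuous χ) (hχper : IsZnPeriodic n χ)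
    (hψχ : ∀ x, ψ x ≤ χ x) (hχ0 : ∀ x, χ x ≤ 0)
    (hχlap : LapEqWeak n {x | ψ x < χ x} χ μ)
    (w : EuclideanSpace ℝ (Fin n) → ℝ)
    (hwc : ContinuousOn w (closure U))
    (hwlap : LapLeWeak n U w lam⁻¹)
    (hwψ : ∀ x ∈ U, ε ^ p * ψ (ε⁻¹ • x) ≤ w x)
    (hwbdry : ∀ x ∈ frontier U, 0 < w x) :
    ∀ x ∈ U, ε ^ p * χ (ε⁻¹ • x) ≤ w x := by
  have hlam0 : 0 < lam := hlam.1
  have hμ0 : 0 < μ := by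
    rw [hμ]
    positivity
  have hεp : 0 < ε ^ p := Real.rpow_pos_of_pos hε p
  have hμε : ε ^ (p - 2) * μ = lam⁻¹ := by
    rw [hμ, mul_left_comm, ← Real.rpow_add hε]
    norm_num
  rcases Nat.eq_zero_or_pos n with rfl | hn
  · intro x hx
    have hW := hχlap.eq_empty_of_dim_zero hμ0.ne'
    have hle : χ (ε⁻¹ • x) ≤ ψ (ε⁻¹ • x) :=
      not_lt.1 fun hlt => (Set.eq_empty_iff_forall_notMem.1 hW) _ hlt
    exact (mul_le_mul_of_nonneg_left hle hεp.le).trans (hwψ x hx)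
  set v : EuclideanSpace ℝ (Fin n) → ℝ := fun x => ε ^ p * χ (ε⁻¹ • x) with hv
  have hvc : Continuous v := by fun_prop
  have hcU : IsCompact (closure U) := hUb.isCompact_closure
  have hdc : ContinuousOn (fun x => v x - w x) (closure U) := hvc.continuousOn.sub hwc
  set V : Set (EuclideanSpace ℝ (Fin n)) := {x ∈ U | 0 < v x - w x} with hVdef
  have hVU : V ⊆ U := fun x hx => hx.1
  have hVo : IsOpen V :=
    (hdc.mono subset_closure).isOpen_inter_preimage hUo isOpen_Ioi
  set g := (closure U).indicator fun x => v x - w x with hg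
  have hgU : ∀ x ∈ closure U, g x = v x - w x := fun x hx => indicator_of_mem hx _
  have hgi : LocallyIntegrable g volume :=
    ((hdc.integrableOn_compact hcU).integrable_indicator
      isClosed_closure.measurableSet).locallyIntegrable
  have hgc : ContinuousOn g V :=
    (hdc.mono (hVU.trans subset_closure)).congr fun x hx => hgU x (subset_closure (hVU hx))
  have hsub : ∀ φ : EuclideanSpace ℝ (Fin n) → ℝ, ContDiff ℝ (⊤ : ℕ∞) φ → HasCompactSupport φ →
      tsupport φ ⊆ V → (∀ x, 0 ≤ φ x) → 0 ≤ ∫ x, g x * lapl n φ x := by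
    intro φ hφ hφc hφV hφ0
    have hφU := hφV.trans hVU
    have hzero : ∀ x ∉ U, lapl n φ x = 0 := fun x hx =>
      lapl_eq_zero_of_notMem_tsupport fun h => hx (hφU h)
    have hE := hχlap.integral_rescale hε p hφ hφc (fun x hx => by
      have h1 := (hφV hx).2
      have h2 := hwψ x (hφU hx)
      have h3 : ε ^ p * ψ (ε⁻¹ • x) < ε ^ p * χ (ε⁻¹ • x) := by
        simp only [hv] at h1
        linarith
      exact lt_of_mul_lt_mul_left h3 hεp.le) hφ0
    have hW := hwlap φ hφ hφc hφU hφ0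
    rw [hμε] at hE
    rw [← setIntegral_eq_integral_of_forall_compl_eq_zero (s := U)] at hE
    swap
    · exact fun x hx => by rw [hzero x hx, mul_zero]
    rw [← setIntegral_eq_integral_of_forall_compl_eq_zero (s := U) (f := φ)] at hE
    swap
    · exact fun x hx => image_eq_zero_of_notMem_tsupport fun hx' => hx (hφU hx')
    rw [← setIntegral_eq_integral_of_forall_compl_eq_zero (s := U)]
    swap
    · exact fun x hx => by rw [hzero x hx, mul_zero]
    have hlc := continuous_lapl hφ
    have i1 : IntegrableOn (fun x => v x * lapl n φ x) U :=
      ((hvc.mul hlc).continuousOn.integrableOn_compact hcU).mono_set subset_closure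
    have i2 : IntegrableOn (fun x => w x * lapl n φ x) U :=
      ((hwc.mul hlc.continuousOn).integrableOn_compact hcU).mono_set subset_closure
    have hsplit : ∫ x in U, g x * lapl n φ x
        = (∫ x in U, v x * lapl n φ x) - ∫ x in U, w x * lapl n φ x := by
      rw [← integral_sub i1 i2]
      refine setIntegral_congr_fun hUo.measurableSet fun x hx => ?_
      simp only [hgU x (subset_closure hx)]
      ring
    rw [hsplit]
    linarith
  intro x₀ hx₀
  by_contra! hlt
  set η := (v x₀ - w x₀) / 2 with hη
  have hη0 : 0 < η := half_pos (sub_pos.2 hlt)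
  set K : Set (EuclideanSpace ℝ (Fin n)) := closure U ∩ (fun x => v x - w x) ⁻¹' Ici η with hKdef
  have hKc : IsCompact K :=
    hcU.of_isClosed_subset (hdc.preimage_isClosed_of_isClosed isClosed_closure isClosed_Ici)
      inter_subset_left
  have hKU : K ⊆ U := by
    intro x hx
    by_contra hxU
    have h1 := hwbdry x ⟨hx.1, fun h => hxU (interior_subset h)⟩
    have h2 : η ≤ v x - w x := hx.2
    have h3 : v x ≤ 0 := mul_nonpos_of_nonneg_of_nonpos hεp.le (hχ0 _)
    linarith
  have hKV : K ⊆ V := fun x hx => ⟨hKU hx, hη0.trans_le hx.2⟩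
  have hbd : ∀ x ∈ K \ interior K, g x ≤ η := by
    rintro x ⟨hxK, hxi⟩
    rw [hgU x hxK.1]
    by_contra! hgt
    have ho : IsOpen (U ∩ (fun x => v x - w x) ⁻¹' Ioi η) :=
      (hdc.mono subset_closure).isOpen_inter_preimage hUo isOpen_Ioi
    have hoK : U ∩ (fun x => v x - w x) ⁻¹' Ioi η ⊆ K :=
      inter_subset_inter subset_closure (preimage_mono Ioi_subset_Ici_self)
    exact hxi (interior_maximal hoK ho ⟨hKU hxK, hgt⟩)
  have hx₀K : x₀ ∈ K := ⟨subset_closure hx₀, show η ≤ v x₀ - w x₀ by linarith⟩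
  have := le_of_weakly_subharmonic hn hVo hKc hKV hgi hgc hsub hbd x₀ hx₀K
  rw [hgU x₀ hx₀K.1] at this
  linarith
end
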